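/- Let p be a prime, r ≥ 1, m ≥ 1, and let f be a Z_{p^r}-linear endomorphism of (Z_{p^r})^m. Let N = ⟨p⟩^m be the submodule of (Z_{p^r})^m consisting of vectors all of whose coordinates lie in the principal ideal ⟨p⟩ of Z_{p^r}, and let f̄ be the endomorphism of the quotient module (Z_{p^r})^m / N induced by f, i.e., f̄(x + N) = f(x) + N. Then for any x in (Z_{p^r})^m, the coset x + N is a cycle vertex of the quotient system ((Z_{p^r})^m / N, f̄) if and only if the coset x + N contains a cycle vertex of the system ((Z_{p^r})^m, f). -/

import Mathlib

/-- An element `x` is a cycle vertex of the system `(M, f)` if `f^[l] x = x`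
for some positive integer `l`. -/
def IsCycleVertex {M : Type*} (f : M → M) (x : M) : Prop :=
  ∃ l : ℕ, 0 < l ∧ f^[l] x = x

/-- The height of an element `x`: the least `k` such that `f^[k] x` is a cycle vertex. -/
noncomputable def height {M : Type*} (f : M → M) (x : M) : ℕ :=
  sInf {k : ℕ | IsCycleVertex f (f^[k] x)}

/-- The system height: the maximum height over all elements. -/
noncomputable def systemHeight {M : Type*} (f : M → M) : ℕ :=
  sSup (Set.range (height f))

/-- A semiconjugacy maps cycle vertices to cycle vertices. -/
theorem IsCycleVertex.map {α β : Type*} {f : α → α} {g : β → β} {φ : α → β}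
    (h : Function.Semiconj φ f g) {y : α} (hy : IsCycleVertex f y) : IsCycleVertex g (φ y) := by
  obtain ⟨l, hl, hfl⟩ := hy
  exact ⟨l, hl, by rw [← (h.iterate_right l).eq, hfl]⟩

/-- In a finite system, some iterate of any element is a cycle vertex. -/
theorem exists_isCycleVertex_iterate {α : Type*} [Finite α] (f : α → α) (x : α) :
    ∃ k, IsCycleVertex f (f^[k] x) := by
  obtain ⟨i, j, hij, h⟩ := Set.finite_univ.exists_lt_map_eq_of_forall_mem
    (f := fun n : ℕ => f^[n] x) (fun _ => Set.mem_univ _)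
  refine ⟨i, j - i, Nat.sub_pos_of_lt hij, ?_⟩
  rw [← Function.iterate_add_apply, Nat.sub_add_cancel hij.le]
  exact h.symm

/-- If a finite system is semiconjugate to another one by `φ`, then `φ x` is a cycle vertex
if and only if the fiber of `φ` through `x` contains a cycle vertex. -/
theorem Function.Semiconj.isCycleVertex_iff {α β : Type*} [Finite α] {f : α → α} {g : β → β}
    {φ : α → β} (h : Function.Semiconj φ f g) (x : α) :
    IsCycleVertex g (φ x) ↔ ∃ y, φ y = φ x ∧ IsCycleVertex f y := by
  constructor
  · rintro ⟨l, hl, hgl⟩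
    obtain ⟨k, n, hn, hk⟩ := exists_isCycleVertex_iterate f^[l] x
    refine ⟨(f^[l])^[k] x, ?_, l * n, Nat.mul_pos hl hn, ?_⟩
    · rw [((h.iterate_right l).iterate_right k).eq, Function.iterate_fixed hgl]
    · rwa [Function.iterate_mul]
  · rintro ⟨y, hyx, hy⟩
    exact hyx ▸ hy.map h

/-- A coset `x + ⟨p⟩^m` is a cycle vertex of the quotient system
`((ZMod (p^r))^m / ⟨p⟩^m, f̄)` if and only if it contains a cycle vertex of
`((ZMod (p^r))^m, f)`. -/
theorem isCycleVertex_quotient_iff_exists_isCycleVertex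
    (p r m : ℕ) (hp : p.Prime) (hr : 1 ≤ r) (hm : 1 ≤ m)
    (f : (Fin m → ZMod (p ^ r)) →ₗ[ZMod (p ^ r)] (Fin m → ZMod (p ^ r)))
    (N : Submodule (ZMod (p ^ r)) (Fin m → ZMod (p ^ r)))
    (hN : N = Submodule.pi Set.univ (fun _ => Ideal.span {(p : ZMod (p ^ r))}))
    (fbar : ((Fin m → ZMod (p ^ r)) ⧸ N) →ₗ[ZMod (p ^ r)] ((Fin m → ZMod (p ^ r)) ⧸ N))
    (hfbar : ∀ x : Fin m → ZMod (p ^ r),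
      fbar (Submodule.Quotient.mk x) = Submodule.Quotient.mk (f x))
    (x : Fin m → ZMod (p ^ r)) :
    IsCycleVertex ⇑fbar (Submodule.Quotient.mk x) ↔
      ∃ y : Fin m → ZMod (p ^ r),
        (Submodule.Quotient.mk y : (Fin m → ZMod (p ^ r)) ⧸ N) = Submodule.Quotient.mk x ∧
        IsCycleVertex ⇑f y := by
  have : NeZero (p ^ r) := ⟨pow_ne_zero r hp.ne_zero⟩
  have h : Function.Semiconj (Submodule.Quotient.mk (p := N)) f fbar := fun z => (hfbar z).symm
  exact h.isCycleVertex_iff x
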